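/- Let V denote the common value V⁻_NADC = V⁺_NADC of the differential game with averaging dynamics and terminal loss d(·,E), extended by Lipschitz continuity to s = 0, and let V(0) denote its (g0-independent) value at s = 0. Then: if V(0) = 0, the closed set E ⊆ ℝ^d is weakly approachable by player 1 in the repeated game; and if V(0) > 0, then E is weakly excludable by player 2. In particular, every closed set E ⊆ ℝ^d is either weakly approachable or weakly excludable. -/

import Mathlib

open MeasureTheory Set

noncomputable section

/-- Euclidean space `ℝ^n`. -/
abbrev Euc (n : ℕ) := EuclideanSpace ℝ (Fin n)

/-- Measurable controls with values in the set `X`. -/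
def Control {n : ℕ} (X : Set (Euc n)) : Type :=
  {x : ℝ → Euc n // Measurable x ∧ ∀ t, x t ∈ X}

/-- `x` and `y` coincide almost everywhere on `[s0, t]`. -/
def AEEqOn {E : Type*} (s0 t : ℝ) (x y : ℝ → E) : Prop :=
  ∀ᵐ s ∂(volume.restrict (Icc s0 t)), x s = y s

/-- The bilinear vector payoff `xAy = ∑_{i,j} x_i y_j A_{ij} ∈ ℝ^d`. -/
def pay {a b d : ℕ} (A : Fin a → Fin b → Euc d) (x : Euc a) (y : Euc b) : Euc d :=
  ∑ i, ∑ j, (x i * y j) • A i j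

/-- The solution `g^{s0,g0,x,y}(s) = (s0/s) g0 + (1/s) ∫_{s0}^s x(t) A y(t) dt` of the
averaging dynamics `g' = (1/s)(x A y − g)`, `g(s0) = g0`. -/
def traj {a b d : ℕ} (A : Fin a → Fin b → Euc d) (s0 : ℝ) (g0 : Euc d)
    (x : ℝ → Euc a) (y : ℝ → Euc b) (s : ℝ) : Euc d :=
  (s0 / s) • g0 + s⁻¹ • ∫ t in s0..s, pay A (x t) (y t)

/-- Nonanticipative with delay piecewise-constant (NADC) strategies with grid parameter `N`:
the produced control is constant on each `[m/N, (m+1)/N)` and the strategy is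
nonanticipative with delay `1/N`. -/
def IsNADCWith {m n : ℕ} {Y : Set (Euc m)} {X : Set (Euc n)}
    (s0 : ℝ) (N : ℕ) (α : Control Y → Control X) : Prop :=
  0 < N ∧
    (∀ y : Control Y, ∀ k < N, ∃ c, ∀ s ∈ Ico ((k : ℝ) / N) ((k + 1 : ℝ) / N), (α y).1 s = c) ∧
    (∀ k < N, ∀ y y' : Control Y, AEEqOn s0 ((k : ℝ) / N) y.1 y'.1 →
      AEEqOn s0 ((k + 1 : ℝ) / N) (α y).1 (α y').1)

/-- NADC strategies. -/
def IsNADC {m n : ℕ} {Y : Set (Euc m)} {X : Set (Euc n)}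
    (s0 : ℝ) (α : Control Y → Control X) : Prop :=
  ∃ N : ℕ, IsNADCWith s0 N α

/-- The upper value in NADC strategies,
`V⁺(s0,g0) = inf_α sup_y d(g^{s0,g0,α(y),y}(1), E)`. -/
def VplusNADC {a b d : ℕ} (X : Set (Euc a)) (Y : Set (Euc b))
    (A : Fin a → Fin b → Euc d) (E : Set (Euc d)) (s0 : ℝ) (g0 : Euc d) : ℝ :=
  ⨅ α : {α : Control Y → Control X // IsNADC s0 α},
    ⨆ y : Control Y, Metric.infDist (traj A s0 g0 (α.1 y).1 y.1 1) E

/-- The lower value in NADC strategies,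
`V⁻(s0,g0) = sup_β inf_x d(g^{s0,g0,x,β(x)}(1), E)`. -/
def VminusNADC {a b d : ℕ} (X : Set (Euc a)) (Y : Set (Euc b))
    (A : Fin a → Fin b → Euc d) (E : Set (Euc d)) (s0 : ℝ) (g0 : Euc d) : ℝ :=
  ⨆ β : {β : Control X → Control Y // IsNADC s0 β},
    ⨅ x : Control X, Metric.infDist (traj A s0 g0 x.1 (β.1 x).1 1) E

/-- A strategy of player 1 in the repeated game: a map from finite histories of past action
pairs to `X`. -/
def Strat1 {a b : ℕ} (X : Set (Euc a)) : Type :=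
  {σ : List (Euc a × Euc b) → Euc a // ∀ h, σ h ∈ X}

/-- A strategy of player 2 in the repeated game. -/
def Strat2 {a b : ℕ} (Y : Set (Euc b)) : Type :=
  {τ : List (Euc a × Euc b) → Euc b // ∀ h, τ h ∈ Y}

/-- The history of play generated by a pair of strategies after `m` stages. -/
def hist {a b : ℕ} (σ : List (Euc a × Euc b) → Euc a) (τ : List (Euc a × Euc b) → Euc b) :
    ℕ → List (Euc a × Euc b)
  | 0 => []
  | m + 1 => hist σ τ m ++ [(σ (hist σ τ m), τ (hist σ τ m))]

/-- The average payoff `ḡ_n = (1/n) ∑_{m=1}^n x_m A y_m` generated by a pair of strategies. -/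
def avgPay {a b d : ℕ} (A : Fin a → Fin b → Euc d)
    (σ : List (Euc a × Euc b) → Euc a) (τ : List (Euc a × Euc b) → Euc b) (n : ℕ) : Euc d :=
  (n : ℝ)⁻¹ • ((hist σ τ n).map fun p => pay A p.1 p.2).sum

/-- `E` is weakly approachable by player 1. -/
def WeaklyApproachable {a b d : ℕ} (X : Set (Euc a)) (Y : Set (Euc b))
    (A : Fin a → Fin b → Euc d) (E : Set (Euc d)) : Prop :=
  ∀ ε > 0, ∃ N : ℕ, ∀ n ≥ N, ∃ σ : Strat1 X, ∀ τ : Strat2 Y,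
    Metric.infDist (avgPay A σ.1 τ.1 n) E ≤ ε

/-- `E` is weakly excludable by player 2: player 2 can weakly approach the complement of
some `η`-neighborhood of `E`. -/
def WeaklyExcludable {a b d : ℕ} (X : Set (Euc a)) (Y : Set (Euc b))
    (A : Fin a → Fin b → Euc d) (E : Set (Euc d)) : Prop :=
  ∃ η > 0, ∀ ε > 0, ∃ N : ℕ, ∀ n ≥ N, ∃ τ : Strat2 Y, ∀ σ : Strat1 X,
    Metric.infDist (avgPay A σ.1 τ.1 n) (Metric.thickening η E)ᶜ ≤ ε

/-- Step control attached to a sequence of actions. -/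
def stepCtl {m : ℕ} {Y : Set (Euc m)} (n : ℕ) (u : ℕ → Euc m) (hu : ∀ k, u k ∈ Y) : Control Y :=
  ⟨fun t => u ⌊(n : ℝ) * t⌋₊,
    (measurable_from_nat (f := u)).comp (Nat.measurable_floor.comp (measurable_const.mul measurable_id)),
    fun _ => hu _⟩

theorem nadc_value_eq {m l : ℕ} {Y : Set (Euc m)} {X : Set (Euc l)} {s0 : ℝ} (hs0 : 0 ≤ s0)
    {N : ℕ} {α : Control Y → Control X} (hα : IsNADCWith s0 N α) {n : ℕ} (hn : 0 < n)
    (u v : ℕ → Euc m) (hu : ∀ k, u k ∈ Y) (hv : ∀ k, v k ∈ Y) (k : ℕ) (hk : k < n)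
    (huv : ∀ i < k, u i = v i) (hsk : s0 ≤ (k : ℝ) / n) (t : ℝ) (ht : (k : ℝ) / n ≤ t)
    (htj : t < ((k * N / n : ℕ) + 1 : ℝ) / N) :
    (α (stepCtl n u hu)).1 ((k : ℝ) / n) = (α (stepCtl n v hv)).1 t := by
  obtain ⟨hN, hc, hna⟩ := hα
  set j := k * N / n with hj
  have hjN : j < N := by
    rw [hj, Nat.div_lt_iff_lt_mul hn, mul_comm N n]
    exact Nat.mul_lt_mul_of_pos_right hk hN
  have hn' : (0 : ℝ) < n := by exact_mod_cast hn
  have hN' : (0 : ℝ) < N := by exact_mod_cast hN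
  have hjk : (j : ℝ) / N ≤ (k : ℝ) / n := by
    rw [div_le_div_iff₀ hN' hn']
    exact_mod_cast Nat.div_mul_le_self (k * N) n
  obtain ⟨c1, hc1⟩ := hc (stepCtl n u hu) j hjN
  obtain ⟨c2, hc2⟩ := hc (stepCtl n v hv) j hjN
  rw [hc1 _ ⟨hjk, ht.trans_lt htj⟩, hc2 _ ⟨hjk.trans ht, htj⟩]
  have hae : AEEqOn s0 ((j : ℝ) / N) (stepCtl n u hu).1 (stepCtl n v hv).1 := by
    unfold AEEqOn
    rw [ae_restrict_iff' measurableSet_Icc]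
    have h0 : ∀ᵐ s : ℝ, s ∈ ({(k : ℝ) / n} : Set ℝ)ᶜ := compl_mem_ae_iff.2 (measure_singleton _)
    filter_upwards [h0] with s hs hs'
    have hs1 : s < (k : ℝ) / n := lt_of_le_of_ne (hs'.2.trans hjk) (by simpa using hs)
    apply huv
    have h00 : (0 : ℝ) ≤ n * s := mul_nonneg hn'.le (hs0.trans hs'.1)
    rw [Nat.floor_lt h00]
    rw [lt_div_iff₀ hn'] at hs1
    linarith
  have h2 := hna j hjN _ _ hae
  unfold AEEqOn at h2
  rw [ae_restrict_iff' measurableSet_Icc] at h2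
  by_contra hne
  have hsub : Ico ((k : ℝ) / n) (((j : ℕ) + 1 : ℝ) / N) ⊆ {s | ¬ (s ∈ Icc s0 (((j : ℕ) + 1 : ℝ) / N) →
      (α (stepCtl n u hu)).1 s = (α (stepCtl n v hv)).1 s)} := by
    intro s hs
    simp only [mem_setOf_eq]
    intro h
    have := h ⟨hsk.trans hs.1, hs.2.le⟩
    rw [hc1 _ ⟨hjk.trans hs.1, hs.2⟩, hc2 _ ⟨hjk.trans hs.1, hs.2⟩] at this
    exact hne this
  have h3 := measure_mono_null hsub (ae_iff.1 h2)
  rw [Real.volume_Ico, ENNReal.ofReal_eq_zero] at h3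
  linarith [ht.trans_lt htj]

theorem card_cross (N n : ℕ) (hn : 0 < n) (hN : 0 < N) :
    ((Finset.range n).filter (fun k => (k * N / n + 1) * n < (k + 1) * N)).card ≤ N := by
  have hmono : ∀ k k' : ℕ, (k * N / n + 1) * n < (k + 1) * N → k < k' → k * N / n < k' * N / n := by
    intro k k' h hlt
    have h1 : k * N / n + 1 ≤ k' * N / n := by
      rw [Nat.le_div_iff_mul_le hn]
      exact h.le.trans (Nat.mul_le_mul_right _ hlt)
    exact h1
  calc _ ≤ (Finset.range N).card := by
        apply Finset.card_le_card_of_injOn (fun k => k * N / n)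
        · intro k hk
          simp only [Finset.coe_filter, Finset.mem_range, mem_setOf_eq] at hk
          simp only [Finset.coe_range, mem_Iio]
          rw [Nat.div_lt_iff_lt_mul hn, mul_comm N n]
          exact Nat.mul_lt_mul_of_pos_right hk.1 hN
        · intro k hk k' hk' heq
          simp only [Finset.coe_filter, Finset.mem_range, mem_setOf_eq] at hk hk'
          rcases lt_trichotomy k k' with h | h | h
          · exact absurd heq (hmono _ _ hk.2 h).ne
          · exact h
          · exact absurd heq (hmono _ _ hk'.2 h).ne'
    _ = N := Finset.card_range N

theorem card_early (s0 : ℝ) (hs0 : 0 ≤ s0) (n : ℕ) (hn : 0 < n) :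
    (((Finset.range n).filter (fun k : ℕ => (k : ℝ) / n < s0)).card : ℝ) ≤ s0 * n + 1 := by
  have hn' : (0 : ℝ) < n := by exact_mod_cast hn
  have : ((Finset.range n).filter (fun k : ℕ => (k : ℝ) / n < s0)) ⊆
      Finset.range (⌊s0 * n⌋₊ + 1) := by
    intro k hk
    simp only [Finset.mem_filter, Finset.mem_range] at hk ⊢
    rw [Nat.lt_succ_iff]
    apply Nat.le_floor
    rw [div_lt_iff₀ hn'] at hk
    exact hk.2.le
  have h1 := Finset.card_le_card this
  rw [Finset.card_range] at h1
  have h2 : (((Finset.range n).filter (fun k : ℕ => (k : ℝ) / n < s0)).card : ℝ)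
      ≤ (⌊s0 * n⌋₊ : ℝ) + 1 := by exact_mod_cast h1
  linarith [Nat.floor_le (mul_nonneg hs0 hn'.le)]

open Classical in
theorem discretize {m l d : ℕ} {Y : Set (Euc m)} {X : Set (Euc l)} (hY : Y.Nonempty)
    (f : Euc l → Euc m → Euc d) (hf : Continuous (fun p : Euc l × Euc m => f p.1 p.2)) (C : ℝ)
    (hC : ∀ x ∈ X, ∀ y ∈ Y, ‖f x y‖ ≤ C) {s0 : ℝ} (hs0 : 0 ≤ s0)
    {N : ℕ} {α : Control Y → Control X} (hα : IsNADCWith s0 N α) {n : ℕ} (hn : 0 < n) :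
    ∃ s : List (Euc m) → Euc l, (∀ h, s h ∈ X) ∧ ∀ u : ℕ → Euc m, (∀ k, u k ∈ Y) →
      ∃ y : Control Y, ‖(n : ℝ)⁻¹ • ∑ k ∈ Finset.range n, f (s ((List.range k).map u)) (u k)
        - ∫ t in s0..1, f ((α y).1 t) (y.1 t)‖ ≤ C * s0 + 2 * C / n * (N + (s0 * n + 1)) := by
  obtain ⟨y0, hy0⟩ := hY
  have hn' : (0 : ℝ) < n := by exact_mod_cast hn
  have hN : 0 < N := hα.1
  have hN' : (0 : ℝ) < N := by exact_mod_cast hN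
  let w : List (Euc m) → ℕ → Euc m := fun h i => if h.getD i y0 ∈ Y then h.getD i y0 else y0
  have hw : ∀ h i, w h i ∈ Y := by
    intro h i
    simp only [w]
    split_ifs with h1
    · exact h1
    · exact hy0
  refine ⟨fun h => (α (stepCtl n (w h) (hw h))).1 ((h.length : ℝ) / n), fun h => (α _).2.2 _, ?_⟩
  intro u hu
  refine ⟨stepCtl n u hu, ?_⟩
  set y := stepCtl n u hu with hy
  have hwu : ∀ k, ∀ i < k, w ((List.range k).map u) i = u i := by
    intro k i hi
    have : ((List.range k).map u).getD i y0 = u i := by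
      simp [List.getD, hi]
    simp only [w, this, hu, if_true]
  set F : ℝ → Euc d := fun t => f ((α y).1 t) (y.1 t) with hF
  have hFm : Measurable F := hf.measurable.comp ((α y).2.1.prodMk y.2.1)
  have hFC : ∀ t, ‖F t‖ ≤ C := fun t => hC _ ((α y).2.2 t) _ (y.2.2 t)
  have hC0 : 0 ≤ C := (norm_nonneg _).trans (hFC 0)
  have hFi : ∀ p q : ℝ, IntervalIntegrable F volume p q := by
    intro p q
    apply (intervalIntegrable_const (c := C) (μ := volume) (a := p) (b := q)).mono_fun
      hFm.aestronglyMeasurable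
    filter_upwards with t
    rw [Real.norm_of_nonneg hC0]
    exact hFC t
  have hsplit : ∫ t in s0..1, F t = (∫ t in (0:ℝ)..1, F t) - ∫ t in (0:ℝ)..s0, F t := by
    rw [intervalIntegral.integral_interval_sub_left (hFi _ _) (hFi _ _)]
  have hsum : ∫ t in (0:ℝ)..1, F t
      = ∑ k ∈ Finset.range n, ∫ t in ((k : ℝ) / n)..(((k + 1 : ℕ) : ℝ) / n), F t := by
    rw [intervalIntegral.sum_integral_adjacent_intervals (a := fun k : ℕ => (k : ℝ) / n)
      (fun k _ => hFi _ _)]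
    simp [hn'.ne']
  have h0 : ‖∫ t in (0:ℝ)..s0, F t‖ ≤ C * s0 := by
    have := intervalIntegral.norm_integral_le_of_norm_le_const (a := 0) (b := s0) (f := F)
      (C := C) (fun t _ => hFC t)
    rwa [sub_zero, abs_of_nonneg hs0] at this
  set x : ℕ → Euc l := fun k => (α (stepCtl n (w ((List.range k).map u)) (hw _))).1
    ((((List.range k).map u).length : ℝ) / n) with hx
  have hlen : ∀ k : ℕ, ((((k + 1 : ℕ) : ℝ)) / n - (k : ℝ) / n) = (n : ℝ)⁻¹ := by
    intro k; push_cast; field_simp; ring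
  set D : ℕ → Euc d := fun k => (n : ℝ)⁻¹ • f (x k) (u k)
    - ∫ t in ((k : ℝ) / n)..(((k + 1 : ℕ) : ℝ) / n), F t with hD
  set P : ℕ → Prop := fun k => (k * N / n + 1) * n < (k + 1) * N with hP
  set Q : ℕ → Prop := fun k => (k : ℝ) / n < s0 with hQ
  have hDall : ∀ k, ‖D k‖ ≤ 2 * C / n := by
    intro k
    have h1 : ‖(n : ℝ)⁻¹ • f (x k) (u k)‖ ≤ (n : ℝ)⁻¹ * C := by
      rw [norm_smul, Real.norm_of_nonneg (inv_nonneg.2 hn'.le)]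
      exact mul_le_mul_of_nonneg_left (hC _ ((α _).2.2 _) _ (hu k)) (inv_nonneg.2 hn'.le)
    have h2 : ‖∫ t in ((k : ℝ) / n)..(((k + 1 : ℕ) : ℝ) / n), F t‖ ≤ C * (n : ℝ)⁻¹ := by
      have := intervalIntegral.norm_integral_le_of_norm_le_const (a := (k : ℝ) / n)
        (b := ((k + 1 : ℕ) : ℝ) / n) (f := F) (C := C) (fun t _ => hFC t)
      rwa [hlen, abs_of_nonneg (inv_nonneg.2 hn'.le)] at this
    calc ‖D k‖ ≤ _ := norm_sub_le _ _
      _ ≤ (n : ℝ)⁻¹ * C + C * (n : ℝ)⁻¹ := add_le_add h1 h2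
      _ = 2 * C / n := by ring
  have hDgood : ∀ k < n, ¬ P k → ¬ Q k → D k = 0 := by
    intro k hk hp hq
    simp only [hP, hQ, not_lt] at hp hq
    have hp' : (((k + 1 : ℕ) : ℝ)) / n ≤ ((k * N / n : ℕ) + 1 : ℝ) / N := by
      rw [div_le_div_iff₀ hn' hN']
      exact_mod_cast hp
    have hle : (k : ℝ) / n ≤ (((k + 1 : ℕ) : ℝ)) / n := by
      have := hlen k
      have := inv_nonneg.2 hn'.le
      linarith
    have hconst : ∫ t in ((k : ℝ) / n)..(((k + 1 : ℕ) : ℝ) / n), F t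
        = ∫ t in ((k : ℝ) / n)..(((k + 1 : ℕ) : ℝ) / n), f (x k) (u k) := by
      apply intervalIntegral.integral_congr_ae
      have h0 : ∀ᵐ s : ℝ, s ∈ ({((k + 1 : ℕ) : ℝ) / n} : Set ℝ)ᶜ :=
        compl_mem_ae_iff.2 (measure_singleton _)
      filter_upwards [h0] with t ht ht'
      rw [uIoc_of_le hle] at ht'
      have ht2 : t < ((k + 1 : ℕ) : ℝ) / n := lt_of_le_of_ne ht'.2 (by simpa using ht)
      have e1 : x k = (α y).1 t := by
        have := nadc_value_eq hs0 hα hn (w ((List.range k).map u)) u (hw _) hu k hk (hwu k) hq t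
          ht'.1.le (ht2.trans_le hp')
        simpa [hx] using this
      have e2 : y.1 t = u k := by
        have hfl : ⌊(n : ℝ) * t⌋₊ = k := by
          have ht1 := ht'.1
          rw [div_lt_iff₀ hn'] at ht1
          rw [lt_div_iff₀ hn'] at ht2
          push_cast at ht2
          have hk0 : (0 : ℝ) ≤ k := Nat.cast_nonneg k
          rw [Nat.floor_eq_iff (by linarith)]
          constructor <;> linarith
        change u ⌊(n : ℝ) * t⌋₊ = u k
        rw [hfl]
      simp only [hF]
      rw [e1, e2]
    simp only [hD]
    rw [hconst, intervalIntegral.integral_const, hlen, sub_self]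
  have hDle : ∀ k ∈ Finset.range n, ‖D k‖ ≤ (if P k then 2 * C / n else 0)
      + (if Q k then 2 * C / n else 0) := by
    intro k hk
    have hpos : 0 ≤ 2 * C / n := by positivity
    by_cases hp : P k
    · rw [if_pos hp]
      have := hDall k
      split_ifs <;> linarith
    · by_cases hq : Q k
      · rw [if_neg hp, if_pos hq]
        linarith [hDall k]
      · rw [hDgood k (Finset.mem_range.1 hk) hp hq]
        simp [hp, hq]
  have hpos : 0 ≤ 2 * C / n := by positivity
  have hfin : ‖∑ k ∈ Finset.range n, D k‖ ≤ 2 * C / n * (N + (s0 * n + 1)) := by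
    calc _ ≤ ∑ k ∈ Finset.range n, ‖D k‖ := norm_sum_le _ _
      _ ≤ _ := Finset.sum_le_sum hDle
      _ = (((Finset.range n).filter P).card : ℝ) * (2 * C / n)
          + (((Finset.range n).filter Q).card : ℝ) * (2 * C / n) := by
        rw [Finset.sum_add_distrib, ← Finset.sum_filter, ← Finset.sum_filter, Finset.sum_const,
          Finset.sum_const, nsmul_eq_mul, nsmul_eq_mul]
      _ ≤ (N : ℝ) * (2 * C / n) + (s0 * n + 1) * (2 * C / n) := by
        apply add_le_add
        · apply mul_le_mul_of_nonneg_right _ hpos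
          have := card_cross N n hn hN
          have h2 : ((Finset.range n).filter P).card ≤ N := by convert this
          exact_mod_cast h2
        · apply mul_le_mul_of_nonneg_right _ hpos
          have := card_early s0 hs0 n hn
          convert this
      _ = _ := by ring
  have hfinal : (n : ℝ)⁻¹ • ∑ k ∈ Finset.range n, f (x k) (u k) - ∫ t in s0..1, F t
      = (∫ t in (0:ℝ)..s0, F t) + ∑ k ∈ Finset.range n, D k := by
    rw [hsplit, hsum]
    simp only [hD]
    rw [Finset.sum_sub_distrib, Finset.smul_sum]
    abel
  change ‖(n : ℝ)⁻¹ • ∑ k ∈ Finset.range n, f (x k) (u k) - ∫ t in s0..1, F t‖ ≤ _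
  rw [hfinal]
  exact (norm_add_le _ _).trans (add_le_add h0 hfin)

theorem hist_eq {a b : ℕ} (σ : List (Euc a × Euc b) → Euc a) (τ : List (Euc a × Euc b) → Euc b)
    (k : ℕ) : hist σ τ k = (List.range k).map (fun i => (σ (hist σ τ i), τ (hist σ τ i))) := by
  induction k with
  | zero => simp [hist]
  | succ k ih =>
    rw [List.range_succ, List.map_append, ← ih]
    simp [hist]

theorem avgPay_eq {a b d : ℕ} (A : Fin a → Fin b → Euc d)
    (σ : List (Euc a × Euc b) → Euc a) (τ : List (Euc a × Euc b) → Euc b) (n : ℕ) :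
    avgPay A σ τ n = (n : ℝ)⁻¹ • ∑ k ∈ Finset.range n, pay A (σ (hist σ τ k)) (τ (hist σ τ k)) := by
  unfold avgPay
  congr 1
  induction n with
  | zero => simp [hist]
  | succ n ih => rw [Finset.sum_range_succ, ← ih]; simp [hist]

theorem pay_cont {a b d : ℕ} (A : Fin a → Fin b → Euc d) :
    Continuous (fun p : Euc a × Euc b => pay A p.1 p.2) := by
  unfold pay
  fun_prop

theorem pay_bdd {a b d : ℕ} (A : Fin a → Fin b → Euc d) {X : Set (Euc a)} {Y : Set (Euc b)}
    (hX : IsCompact X) (hY : IsCompact Y) :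
    ∃ C : ℝ, 0 < C ∧ ∀ x ∈ X, ∀ y ∈ Y, ‖pay A x y‖ ≤ C := by
  obtain ⟨C, hC⟩ := (hX.prod hY).exists_bound_of_continuousOn (pay_cont A).continuousOn
  exact ⟨max C 1, by positivity, fun x hx y hy => (hC (x, y) ⟨hx, hy⟩).trans (le_max_left _ _)⟩

theorem traj_zero {a b d : ℕ} (A : Fin a → Fin b → Euc d) (s0 : ℝ)
    (x : ℝ → Euc a) (y : ℝ → Euc b) :
    traj A s0 0 x y 1 = ∫ t in s0..1, pay A (x t) (y t) := by
  simp [traj]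

theorem nadc_nonempty {m n : ℕ} {Y : Set (Euc m)} {X : Set (Euc n)} (hX : X.Nonempty) (s0 : ℝ) :
    Nonempty {α : Control Y → Control X // IsNADC s0 α} := by
  obtain ⟨x, hx⟩ := hX
  refine ⟨⟨fun _ => ⟨fun _ => x, measurable_const, fun _ => hx⟩, 1, one_pos, ?_, ?_⟩⟩
  · exact fun _ _ _ => ⟨x, fun _ _ => rfl⟩
  · intro k _ y y' _
    exact Filter.Eventually.of_forall fun _ => rfl

theorem err_small {C s0 ε : ℝ} (hC : 0 < C) (N n : ℕ) (hn : 0 < n)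
    (h1 : 3 * C * s0 ≤ ε / 2) (h2 : 4 * C * (N + 1) / ε ≤ n) (hε : 0 < ε) :
    C * s0 + 2 * C / n * (N + (s0 * n + 1)) ≤ ε := by
  have hn' : (0 : ℝ) < n := by exact_mod_cast hn
  rw [div_le_iff₀ hε] at h2
  have : C * s0 + 2 * C / n * (N + (s0 * n + 1)) = 3 * C * s0 + (2 * C * (N + 1)) / n := by
    field_simp; ring
  rw [this]
  have : (2 * C * (N + 1)) / n ≤ ε / 2 := by
    rw [div_le_iff₀ hn']; linarith
  linarith

theorem infDist_close {d : ℕ} {p q : Euc d} {E : Set (Euc d)} {δ : ℝ} (h : ‖p - q‖ ≤ δ) :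
    Metric.infDist p E ≤ Metric.infDist q E + δ := by
  have := Metric.infDist_le_infDist_add_dist (s := E) (x := p) (y := q)
  rw [dist_eq_norm] at this
  linarith

theorem exists_small_time {f : ℝ → ℝ} {v0 : ℝ}
    (h : Filter.Tendsto f (nhdsWithin 0 (Ioc (0 : ℝ) 1)) (nhds v0)) {ε δ : ℝ} (hε : 0 < ε)
    (hδ : 0 < δ) : ∃ s ∈ Ioc (0 : ℝ) 1, s ≤ δ ∧ |f s - v0| < ε := by
  have hne : (nhdsWithin (0 : ℝ) (Ioc (0 : ℝ) 1)).NeBot := by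
    rw [nhdsWithin_Ioc_eq_nhdsGT one_pos]; infer_instance
  have h1 := Metric.tendsto_nhds.1 h ε hε
  have h2 : ∀ᶠ s in nhdsWithin (0 : ℝ) (Ioc (0 : ℝ) 1), s ≤ δ :=
    nhdsWithin_le_nhds (Iic_mem_nhds hδ)
  obtain ⟨s, ⟨hs1, hs2⟩, hs3⟩ := ((h1.and h2).and self_mem_nhdsWithin).exists
  exact ⟨s, hs3, hs2, by simpa [Real.dist_eq] using hs1⟩

theorem approach_of_zero {a b d : ℕ} (X : Set (Euc a)) (Y : Set (Euc b))
    (hXc : IsCompact X) (hXne : X.Nonempty) (hYc : IsCompact Y) (hYne : Y.Nonempty)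
    (A : Fin a → Fin b → Euc d) (E : Set (Euc d))
    (hv0 : Filter.Tendsto (fun s => VplusNADC X Y A E s 0)
      (nhdsWithin 0 (Ioc (0 : ℝ) 1)) (nhds 0)) : WeaklyApproachable X Y A E := by
  intro ε hε
  obtain ⟨C, hC0, hC⟩ := pay_bdd A hXc hYc
  obtain ⟨s0, hs0, hsδ, hV⟩ := exists_small_time hv0 (half_pos hε)
    (show 0 < ε / (12 * C) by positivity)
  rw [sub_zero] at hV
  have hne : Nonempty {α : Control Y → Control X // IsNADC s0 α} := nadc_nonempty hXne s0
  obtain ⟨⟨α, N, hα⟩, hαlt⟩ := exists_lt_of_ciInf_lt (lt_of_abs_lt hV)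
  have hs0' : 3 * C * s0 ≤ (ε / 2) / 2 := by
    rw [le_div_iff₀ (by positivity)] at hsδ; linarith
  refine ⟨⌈4 * C * (N + 1) / (ε / 2)⌉₊ + 1, fun n hn => ?_⟩
  have hn0 : 0 < n := by omega
  have hnb : 4 * C * (N + 1) / (ε / 2) ≤ n :=
    (Nat.le_ceil _).trans (by exact_mod_cast (Nat.le_succ _).trans hn)
  have herr := err_small hC0 N n hn0 hs0' hnb (half_pos hε)
  obtain ⟨s, hsX, hs⟩ := discretize hYne (pay A) (pay_cont A) C hC hs0.1.le hα hn0
  refine ⟨⟨fun h => s (h.map Prod.snd), fun h => hsX _⟩, fun τ => ?_⟩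
  obtain ⟨y, hy⟩ := hs (fun k => τ.1 (hist (fun h => s (h.map Prod.snd)) τ.1 k)) (fun k => τ.2 _)
  have hbdd : BddAbove (range fun y : Control Y =>
      Metric.infDist (traj A s0 0 (α y).1 y.1 1) E) := by
    refine ⟨Metric.infDist 0 E + C * |1 - s0|, ?_⟩
    rintro _ ⟨y, rfl⟩
    apply infDist_close
    rw [sub_zero, traj_zero]
    exact intervalIntegral.norm_integral_le_of_norm_le_const
      (fun t _ => hC _ ((α y).2.2 t) _ (y.2.2 t))
  have hle := le_ciSup hbdd y
  have hkey : ‖avgPay A (fun h => s (h.map Prod.snd)) τ.1 n - traj A s0 0 (α y).1 y.1 1‖ ≤ ε / 2 := by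
    rw [avgPay_eq, traj_zero]
    refine le_trans (le_of_eq ?_) (hy.trans herr)
    congr 3
    apply Finset.sum_congr rfl
    intro k _
    congr 2
    conv_lhs => rw [hist_eq]
    simp [List.map_map, Function.comp_def]
  have := infDist_close (E := E) hkey
  simp only at hle hαlt ⊢
  linarith

theorem exclude_of_pos {a b d : ℕ} (X : Set (Euc a)) (Y : Set (Euc b))
    (hXc : IsCompact X) (hXne : X.Nonempty) (hYc : IsCompact Y) (hYne : Y.Nonempty)
    (A : Fin a → Fin b → Euc d) (E : Set (Euc d)) (v0 : ℝ) (hv : 0 < v0)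
    (hv0 : Filter.Tendsto (fun s => VminusNADC X Y A E s 0)
      (nhdsWithin 0 (Ioc (0 : ℝ) 1)) (nhds v0)) : WeaklyExcludable X Y A E := by
  obtain ⟨C, hC0, hC⟩ := pay_bdd A hXc hYc
  set ε := v0 / 4 with hεdef
  have hε : 0 < ε := by positivity
  refine ⟨ε, hε, fun ε' hε' => ?_⟩
  obtain ⟨s0, hs0, hsδ, hV⟩ := exists_small_time hv0 hε
    (show 0 < ε / (6 * C) by positivity)
  have hne : Nonempty {β : Control X → Control Y // IsNADC s0 β} := nadc_nonempty hYne s0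
  have hV2 : 2 * ε < VminusNADC X Y A E s0 0 := by
    have := (abs_lt.1 hV).1
    linarith
  obtain ⟨⟨β, N, hβ⟩, hβlt⟩ := exists_lt_of_lt_ciSup hV2
  have hs0' : 3 * C * s0 ≤ ε / 2 := by
    rw [le_div_iff₀ (by positivity)] at hsδ; linarith
  refine ⟨⌈4 * C * (N + 1) / ε⌉₊ + 1, fun n hn => ?_⟩
  have hn0 : 0 < n := by omega
  have hnb : 4 * C * (N + 1) / ε ≤ n :=
    (Nat.le_ceil _).trans (by exact_mod_cast (Nat.le_succ _).trans hn)
  have herr := err_small hC0 N n hn0 hs0' hnb hε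
  obtain ⟨s, hsY, hs⟩ := discretize hXne (fun y x => pay A x y)
    ((pay_cont A).comp continuous_swap) C (fun y hy x hx => hC x hx y hy) hs0.1.le hβ hn0
  refine ⟨⟨fun h => s (h.map Prod.fst), fun h => hsY _⟩, fun σ => ?_⟩
  obtain ⟨x, hx⟩ := hs (fun k => σ.1 (hist σ.1 (fun h => s (h.map Prod.fst)) k)) (fun k => σ.2 _)
  have hbdd : BddBelow (range fun x : Control X =>
      Metric.infDist (traj A s0 0 x.1 (β x).1 1) E) := by
    refine ⟨0, ?_⟩
    rintro _ ⟨y, rfl⟩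
    exact Metric.infDist_nonneg
  have hle := ciInf_le hbdd x
  have hkey : ‖avgPay A σ.1 (fun h => s (h.map Prod.fst)) n - traj A s0 0 x.1 (β x).1 1‖ ≤ ε := by
    rw [avgPay_eq, traj_zero]
    refine le_trans (le_of_eq ?_) (hx.trans herr)
    congr 3
    apply Finset.sum_congr rfl
    intro k _
    congr 2
    conv_lhs => rw [hist_eq]
    simp [List.map_map, Function.comp_def]
  rw [norm_sub_rev] at hkey
  have h3 := infDist_close (E := E) hkey
  have hmem : avgPay A σ.1 (fun h => s (h.map Prod.fst)) n ∈ (Metric.thickening ε E)ᶜ := by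
    intro hmem
    obtain ⟨z, hz, hzd⟩ := Metric.mem_thickening_iff.1 hmem
    have h4 := Metric.infDist_le_dist_of_mem (x := avgPay A σ.1 (fun h => s (h.map Prod.fst)) n) hz
    simp only at hle hβlt
    linarith
  have := Metric.infDist_zero_of_mem hmem
  simp only
  rw [this]
  exact hε'.le

/-- Let `V` be the common value `V⁻_NADC = V⁺_NADC`, extended by continuity
to `s = 0`, with (g0-independent) value `v0` at `0`. If `v0 = 0` then `E` is weakly
approachable by player 1, and if `v0 > 0` then `E` is weakly excludable by player 2; in
particular `E` is either weakly approachable or weakly excludable. -/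
theorem statement5 {a b d : ℕ} (X : Set (Euc a)) (Y : Set (Euc b))
    (hXc : IsCompact X) (hXconv : Convex ℝ X) (hXne : X.Nonempty)
    (hYc : IsCompact Y) (hYconv : Convex ℝ Y) (hYne : Y.Nonempty)
    (A : Fin a → Fin b → Euc d) (E : Set (Euc d)) (hE : IsClosed E)
    (hval : ∀ s ∈ Ioc (0 : ℝ) 1, ∀ g0 : Euc d,
      VminusNADC X Y A E s g0 = VplusNADC X Y A E s g0)
    (v0 : ℝ)
    (hv0 : ∀ g0 : Euc d, Filter.Tendsto (fun s => VplusNADC X Y A E s g0)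
      (nhdsWithin 0 (Ioc (0 : ℝ) 1)) (nhds v0)) :
    (v0 = 0 → WeaklyApproachable X Y A E) ∧
    (0 < v0 → WeaklyExcludable X Y A E) ∧
    (WeaklyApproachable X Y A E ∨ WeaklyExcludable X Y A E) := by
  have hA : v0 = 0 → WeaklyApproachable X Y A E := by
    rintro rfl
    exact approach_of_zero X Y hXc hXne hYc hYne A E (hv0 0)
  have hB : 0 < v0 → WeaklyExcludable X Y A E := by
    intro hv
    refine exclude_of_pos X Y hXc hXne hYc hYne A E v0 hv ((hv0 0).congr' ?_)
    filter_upwards [self_mem_nhdsWithin] with s hs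
    exact (hval s hs 0).symm
  have hnn : 0 ≤ v0 := by
    have hne : (nhdsWithin (0 : ℝ) (Ioc (0 : ℝ) 1)).NeBot := by
      rw [nhdsWithin_Ioc_eq_nhdsGT one_pos]; infer_instance
    refine ge_of_tendsto (hv0 0) (Filter.Eventually.of_forall fun s => ?_)
    exact Real.iInf_nonneg fun α => Real.iSup_nonneg fun y => Metric.infDist_nonneg
  refine ⟨hA, hB, ?_⟩
  rcases hnn.eq_or_lt with h | h
  · exact Or.inl (hA h.symm)
  · exact Or.inr (hB h)
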